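/- Let μ ∈ Prob(Γ) and suppose Γ admits an essentially free μ-USB. Let Λ ≤ Γ be a co-amenable subgroup. Then any non-singular μ-stationary measurable action of Γ on a standard probability space (X,ν) whose restriction to Λ is essentially free, is essentially free. -/

import Mathlib

noncomputable section
open scoped ComplexOrder ENNReal
open MeasureTheory Filter Topology
set_option linter.unusedSectionVars false
set_option maxHeartbeats 1000000
set_option synthInstance.maxHeartbeats 400000

namespace RW

/-- A probability distribution on a (countable discrete) group. -/
structure ProbOn (Γ : Type*) where
  w : Γ → ℝ
  nonneg : ∀ g, 0 ≤ w g
  hasSum : HasSum w 1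

/-- `μ` is generating: the semigroup generated by its support is the whole group. -/
def ProbOn.Generating {Γ : Type*} [Group Γ] (μ : ProbOn Γ) : Prop :=
  ∀ g : Γ, ∃ l : List Γ, l ≠ [] ∧ (∀ x ∈ l, 0 < μ.w x) ∧ l.prod = g

section Amenable

/-- ℓ∞ translation of a bounded function under a group action. -/
def lpShift {G S : Type*} [Group G] [MulAction G S] (g : G)
    (f : lp (fun _ : S => ℝ) ∞) : lp (fun _ : S => ℝ) ∞ :=
  ⟨fun x => f (g⁻¹ • x), by
    have h : Memℓp (f : ∀ _ : S, ℝ) ∞ := lp.memℓp f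
    rw [memℓp_infty_iff] at h
    refine memℓp_infty (BddAbove.mono ?_ h)
    rintro _ ⟨x, rfl⟩
    exact ⟨g⁻¹ • x, rfl⟩⟩

/-- Existence of an invariant mean on `ℓ∞(S)` for an action of `G` on `S`: a positive,
unital, `G`-invariant linear functional. -/
def HasInvariantMean (G S : Type*) [Group G] [MulAction G S] : Prop :=
  ∃ m : (lp (fun _ : S => ℝ) ∞) →ₗ[ℝ] ℝ,
    (∀ f, (∀ x, 0 ≤ f x) → 0 ≤ m f) ∧
    m 1 = 1 ∧
    (∀ (g : G) (f), m (lpShift g f) = m f)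

/-- A group is amenable if `ℓ∞` of it carries a left-invariant mean. -/
def IsAmenable (G : Type*) [Group G] : Prop := HasInvariantMean G G

/-- A subgroup is co-amenable if there is a `Γ`-invariant mean on `ℓ∞(Γ/Λ)`. -/
def IsCoamenable {Γ : Type*} [Group Γ] (Λ : Subgroup Γ) : Prop :=
  HasInvariantMean Γ (Γ ⧸ Λ)

/-- `Γ` has trivial amenable radical: it has no non-trivial amenable normal subgroup. -/
def HasTrivialAmenableRadical (Γ : Type*) [Group Γ] : Prop :=
  ∀ N : Subgroup Γ, N.Normal → IsAmenable ↥N → N = ⊥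

end Amenable

section Meas

variable {Γ : Type*} [Group Γ] {X : Type*} [MeasurableSpace X] [MulAction Γ X]

/-- `ν` is `μ`-stationary: `ν = ∑_g μ(g) g_*ν`. -/
def IsStatMeasure (μ : ProbOn Γ) (ν : Measure X) : Prop :=
  ν = Measure.sum (fun g : Γ => ENNReal.ofReal (μ.w g) • Measure.map (fun x : X => g • x) ν)

/-- Position of the `(Γ,μ)`-random walk at time `n`, given the sequence of increments. -/
def walk (x : ℕ → Γ) (n : ℕ) : Γ := (List.ofFn (fun i : Fin n => x i)).prod

/-- `P` is the Bernoulli measure `μ^⊗ℕ` on the space of increments of the random walk;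
the path measure ℙ_μ is its push-forward under partial products. -/
def IsBernoulli [MeasurableSpace Γ] (μ : ProbOn Γ) (P : Measure (ℕ → Γ)) : Prop :=
  IsProbabilityMeasure P ∧
  ∀ (n : ℕ) (s : Fin n → Γ), P {x | ∀ i : Fin n, x (i : ℕ) = s i}
      = ∏ i, ENNReal.ofReal (μ.w (s i))

/-- Essential freeness of an action on a measure space. -/
def IsEssFree (Γ : Type*) [Group Γ] {X : Type*} [MeasurableSpace X] [MulAction Γ X]
    (ν : Measure X) : Prop :=
  ∀ g : Γ, g ≠ 1 → ν {x : X | g • x = x} = 0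

/-- Essential freeness of the restriction of the action to a subgroup. -/
def IsEssFreeOn (Λ : Subgroup Γ) (ν : Measure X) : Prop :=
  ∀ h : Γ, h ∈ Λ → h ≠ 1 → ν {x : X | h • x = x} = 0

/-- The action is non-singular: each translate of `ν` is equivalent to `ν`. -/
def IsNonSingular (Γ : Type*) [Group Γ] {X : Type*} [MeasurableSpace X] [MulAction Γ X]
    (ν : Measure X) : Prop :=
  ∀ g : Γ, Measure.map (fun x : X => g • x) ν ≪ ν ∧ ν ≪ Measure.map (fun x : X => g • x) ν

end Meas

section TopMeas

variable {Γ : Type*} [Group Γ] {X : Type*} [TopologicalSpace X] [MeasurableSpace X] [MulAction Γ X]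

/-- Weak* convergence of the pushforwards of `ν` under a sequence of group elements
to the Dirac measure at `z`. -/
def TendstoDirac (ν : Measure X) (ws : ℕ → Γ) (z : X) : Prop :=
  ∀ f : C(X, ℝ), Tendsto (fun n => ∫ y, f y ∂(Measure.map (fun x : X => ws n • x) ν))
    atTop (nhds (f z))

/-- `(X, ν)` is a `μ`-boundary: `ν` is a `μ`-stationary probability measure and for
ℙ_μ-almost every path `ω` of the random walk the measures `(ω_n)_*ν` converge weak* to
a Dirac measure. -/
def IsMuBoundary [MeasurableSpace Γ] (μ : ProbOn Γ) (ν : Measure X) : Prop :=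
  IsProbabilityMeasure ν ∧ IsStatMeasure μ ν ∧
  ∀ P : Measure (ℕ → Γ), IsBernoulli μ P →
    ∀ᵐ x ∂P, ∃ z : X, TendstoDirac ν (walk x) z

/-- `(X, ν)` is a `μ`-USB: a `μ`-boundary whose measure is the unique `μ`-stationary
probability measure on `X`. -/
def IsUSB [MeasurableSpace Γ] (μ : ProbOn Γ) (ν : Measure X) : Prop :=
  IsMuBoundary μ ν ∧
  ∀ ν' : Measure X, IsProbabilityMeasure ν' → IsStatMeasure μ ν' → ν' = ν

/-- The support of a measure: points all of whose neighbourhoods have positive measure. -/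
def msupport (ν : Measure X) : Set X := {x : X | ∀ U : Set X, IsOpen U → x ∈ U → 0 < ν U}

/-- `X` is a mean-proximal `Γ`-space: for every generating `μ` there is a unique
`μ`-stationary probability measure, and it makes `X` a `μ`-boundary. -/
def IsMeanProximal (Γ X : Type*) [Group Γ] [MeasurableSpace Γ] [TopologicalSpace X]
    [MeasurableSpace X] [MulAction Γ X] : Prop :=
  ∀ μ : ProbOn Γ, μ.Generating →
    ∃ ν : Measure X, IsMuBoundary μ ν ∧
      ∀ ν' : Measure X, IsProbabilityMeasure ν' → IsStatMeasure μ ν' → ν' = ν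

end TopMeas

end RW

namespace RW

section Walk

variable {Γ : Type*}

lemma ProbOn.tsum_ofReal (μ : ProbOn Γ) : ∑' g, ENNReal.ofReal (μ.w g) = 1 := by
  rw [← ENNReal.ofReal_tsum_of_nonneg μ.nonneg μ.hasSum.summable, μ.hasSum.tsum_eq,
    ENNReal.ofReal_one]

lemma ProbOn.summable_mul (μ : ProbOn Γ) {φ : Γ → ℝ} {C : ℝ} (hφ : ∀ g, |φ g| ≤ C) :
    Summable fun g => μ.w g * φ g := by
  refine Summable.of_norm_bounded (μ.hasSum.summable.mul_right C) fun g => ?_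
  rw [Real.norm_eq_abs, abs_mul, abs_of_nonneg (μ.nonneg g)]
  exact mul_le_mul_of_nonneg_left (hφ g) (μ.nonneg g)

lemma ProbOn.tsum_mul_const (μ : ProbOn Γ) (c : ℝ) : ∑' g, μ.w g * c = c := by
  rw [tsum_mul_right, μ.hasSum.tsum_eq, one_mul]

/-- The Borel probability measure on the discrete group with weights `μ.w`. -/
def ProbOn.toMeasure [MeasurableSpace Γ] (μ : ProbOn Γ) : Measure Γ :=
  Measure.sum fun g => ENNReal.ofReal (μ.w g) • Measure.dirac g

instance [MeasurableSpace Γ] (μ : ProbOn Γ) : IsProbabilityMeasure μ.toMeasure where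
  measure_univ := by
    rw [ProbOn.toMeasure, Measure.sum_apply _ MeasurableSet.univ]
    simpa using μ.tsum_ofReal

variable [MeasurableSpace Γ] [DiscreteMeasurableSpace Γ]

lemma ProbOn.toMeasure_singleton (μ : ProbOn Γ) (g : Γ) :
    μ.toMeasure {g} = ENNReal.ofReal (μ.w g) := by
  rw [ProbOn.toMeasure, Measure.sum_apply _ (measurableSet_singleton g), tsum_eq_single g]
  · simp
  · intro b hb
    simp [hb]

lemma ProbOn.integral_toMeasure (μ : ProbOn Γ) {φ : Γ → ℝ} {C : ℝ} (hφ : ∀ g, |φ g| ≤ C) :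
    ∫ g, φ g ∂μ.toMeasure = ∑' g, μ.w g * φ g := by
  have hint : Integrable φ μ.toMeasure :=
    Integrable.of_bound Measurable.of_discrete.aestronglyMeasurable C
      (Eventually.of_forall fun g => hφ g)
  rw [ProbOn.toMeasure] at hint ⊢
  rw [integral_sum_measure hint]
  simp [integral_smul_measure, ENNReal.toReal_ofReal (μ.nonneg _)]

variable [Group Γ]

lemma walk_succ (x : ℕ → Γ) (n : ℕ) : walk x (n + 1) = walk x n * x n := by
  rw [walk, List.ofFn_succ_last]
  simp [walk]

lemma measurable_walk [Countable Γ] (n : ℕ) : Measurable fun x : ℕ → Γ => walk x n := by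
  induction n with
  | zero => simp only [walk, List.ofFn_zero, List.prod_nil]; exact measurable_const
  | succ n ih =>
    simp only [walk_succ]
    exact (Measurable.of_discrete (f := fun p : Γ × Γ => p.1 * p.2)).comp
      (ih.prodMk (measurable_pi_apply n))

/-- The Bernoulli measure on the increments. -/
def ProbOn.bernoulli (μ : ProbOn Γ) : Measure (ℕ → Γ) :=
  Measure.infinitePi fun _ : ℕ => μ.toMeasure

instance (μ : ProbOn Γ) : IsProbabilityMeasure μ.bernoulli := by
  unfold ProbOn.bernoulli; infer_instance

lemma ProbOn.isBernoulli_bernoulli (μ : ProbOn Γ) : IsBernoulli μ μ.bernoulli := by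
  refine ⟨inferInstance, fun n s => ?_⟩
  have hset : {x : ℕ → Γ | ∀ i : Fin n, x (i : ℕ) = s i}
      = Set.pi (Finset.range n) fun i => if h : i < n then {s ⟨i, h⟩} else Set.univ := by
    ext x
    simp only [Set.mem_ofPred_eq, Set.mem_pi, Finset.coe_range, Set.mem_Iio]
    refine ⟨fun h i hi => by simp [hi, h ⟨i, hi⟩], fun h i => by simpa using h i i.2⟩
  rw [hset, ProbOn.bernoulli, Measure.infinitePi_pi _ (fun i _ => .of_discrete),
    Finset.prod_range]
  refine Finset.prod_congr rfl fun i _ => ?_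
  simp [μ.toMeasure_singleton]

lemma ProbOn.indepFun_walk [Countable Γ] (μ : ProbOn Γ) (n : ℕ) :
    ProbabilityTheory.IndepFun (fun x : ℕ → Γ => walk x n) (fun x => x n) μ.bernoulli := by
  have hind : ProbabilityTheory.iIndepFun (fun (i : ℕ) (x : ℕ → Γ) => x i) μ.bernoulli :=
    ProbabilityTheory.iIndepFun_infinitePi (P := fun _ : ℕ => μ.toMeasure)
      (X := fun _ g => g) fun _ => measurable_id
  have h := hind.indepFun_finset (Finset.range n) {n} (by simp) fun i => measurable_pi_apply i
  refine h.comp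
    (φ := fun y : (Finset.range n → Γ) =>
      (List.ofFn fun i : Fin n => y ⟨i, Finset.mem_range.2 i.2⟩).prod)
    (ψ := fun y : (({n} : Finset ℕ) → Γ) => y ⟨n, Finset.mem_singleton_self n⟩)
    .of_discrete .of_discrete

/-- A bounded `μ`-harmonic function has constant expectation along the random walk. -/
lemma ProbOn.integral_walk_of_harmonic [Countable Γ] (μ : ProbOn Γ) {φ : Γ → ℝ} {C : ℝ}
    (hφ : ∀ g, |φ g| ≤ C) (hharm : ∀ g, φ g = ∑' h, μ.w h * φ (g * h)) (n : ℕ) :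
    ∫ x, φ (walk x n) ∂μ.bernoulli = φ 1 := by
  induction n with
  | zero => simp [walk]
  | succ n ih =>
    have hmap := (ProbabilityTheory.indepFun_iff_map_prod_eq_prod_map_map
      (measurable_walk n).aemeasurable (measurable_pi_apply n).aemeasurable).1 (μ.indepFun_walk n)
    have hlaw : μ.bernoulli.map (fun x => x n) = μ.toMeasure :=
      Measure.infinitePi_map_eval (fun _ : ℕ => μ.toMeasure) n
    have : IsProbabilityMeasure (μ.bernoulli.map fun x => walk x n) :=
      Measure.isProbabilityMeasure_map (measurable_walk n).aemeasurable
    rw [hlaw] at hmap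
    have hmeas : Measurable fun x : ℕ → Γ => (walk x n, x n) :=
      (measurable_walk n).prodMk (measurable_pi_apply n)
    calc ∫ x, φ (walk x (n + 1)) ∂μ.bernoulli
        = ∫ p : Γ × Γ, φ (p.1 * p.2) ∂(μ.bernoulli.map fun x => (walk x n, x n)) := by
          rw [integral_map hmeas.aemeasurable Measurable.of_discrete.aestronglyMeasurable]
          simp only [walk_succ]
      _ = ∫ g, ∫ h, φ (g * h) ∂μ.toMeasure ∂(μ.bernoulli.map fun x => walk x n) := by
          rw [hmap, integral_prod]
          exact Integrable.of_bound Measurable.of_discrete.aestronglyMeasurable C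
            (Eventually.of_forall fun p => hφ _)
      _ = ∫ g, φ g ∂(μ.bernoulli.map fun x => walk x n) := by
          refine integral_congr_ae (Eventually.of_forall fun g => ?_)
          simp only
          rw [μ.integral_toMeasure fun h => hφ (g * h), ← hharm]
      _ = φ 1 := by
          rw [integral_map (measurable_walk n).aemeasurable
            Measurable.of_discrete.aestronglyMeasurable, ih]

end Walk

section Stationary

variable {Γ : Type*} [Group Γ] {X : Type*} [MeasurableSpace X] [MulAction Γ X]

lemma IsStatMeasure.integral_eq {μ : ProbOn Γ} {ν : Measure X} [IsProbabilityMeasure ν]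
    (hmeas : ∀ g : Γ, Measurable fun x : X => g • x) (hstat : IsStatMeasure μ ν)
    {F : X → ℝ} (hF : Measurable F) {C : ℝ} (hC : ∀ x, |F x| ≤ C) :
    ∫ x, F x ∂ν = ∑' h, μ.w h * ∫ x, F (h • x) ∂ν := by
  have hint : Integrable F ν :=
    Integrable.of_bound hF.aestronglyMeasurable C (Eventually.of_forall hC)
  conv_lhs => rw [hstat]
  rw [hstat] at hint
  rw [integral_sum_measure hint]
  refine tsum_congr fun h => ?_
  rw [integral_smul_measure, integral_map (hmeas h).aemeasurable hF.aestronglyMeasurable,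
    ENNReal.toReal_ofReal (μ.nonneg h), smul_eq_mul]

lemma mem_fixedBy_conj {g h : Γ} {x : X} :
    x ∈ MulAction.fixedBy X (h⁻¹ * g * h) ↔ h • x ∈ MulAction.fixedBy X g := by
  simp only [MulAction.mem_fixedBy, mul_smul]
  exact inv_smul_eq_iff

lemma IsStatMeasure.real_fixedBy {μ : ProbOn Γ} {ν : Measure X} [IsProbabilityMeasure ν]
    (hmeas : ∀ g : Γ, Measurable fun x : X => g • x) (hstat : IsStatMeasure μ ν) {g : Γ}
    (hg : ∀ g : Γ, MeasurableSet (MulAction.fixedBy X g)) :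
    ν.real (MulAction.fixedBy X g)
      = ∑' h, μ.w h * ν.real (MulAction.fixedBy X (h⁻¹ * g * h)) := by
  have h := hstat.integral_eq hmeas (F := (MulAction.fixedBy X g).indicator 1)
    (measurable_one.indicator (hg g)) (C := 1) (fun x => by
      by_cases hx : x ∈ MulAction.fixedBy X g <;> simp [hx])
  rw [integral_indicator_one (hg g)] at h
  rw [h]
  refine tsum_congr fun k => ?_
  rw [← integral_indicator_one (hg _)]
  congr 2
  ext x
  by_cases hx : k • x ∈ MulAction.fixedBy X g
  · rw [Set.indicator_of_mem hx, Set.indicator_of_mem (mem_fixedBy_conj.2 hx)]; rfl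
  · rw [Set.indicator_of_notMem hx, Set.indicator_of_notMem (mt mem_fixedBy_conj.1 hx)]

end Stationary

section FixedPoint

variable {Γ J : Type*}

/-- A compact convex set of functions that is invariant under a Markov operator contains a fixed
point of that operator. -/
theorem ProbOn.exists_fixed_of_convex (μ : ProbOn Γ) (σ : Γ → J → J) {C : J → ℝ}
    (hC : ∀ h j, C (σ h j) ≤ C j) {K : Set (J → ℝ)} (hclosed : IsClosed K) (hconv : Convex ℝ K)
    (hne : K.Nonempty) (hbdd : ∀ A ∈ K, ∀ j, |A j| ≤ C j)
    (hinv : ∀ A ∈ K, (fun j => ∑' h, μ.w h * A (σ h j)) ∈ K) :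
    ∃ B ∈ K, ∀ j, B j = ∑' h, μ.w h * B (σ h j) := by
  obtain ⟨A₀, hA₀⟩ := hne
  set T : (J → ℝ) → J → ℝ := fun A j => ∑' h, μ.w h * A (σ h j) with hT
  have hiter : ∀ n, T^[n] A₀ ∈ K := by
    intro n
    induction n with
    | zero => exact hA₀
    | succ n ih => rw [Function.iterate_succ_apply']; exact hinv _ ih
  have hbdd' : ∀ A ∈ K, ∀ h j, |A (σ h j)| ≤ C j := fun A hA h j => (hbdd A hA _).trans (hC h j)
  set c : ℕ → J → ℝ := fun n => ∑ i ∈ Finset.range (n + 1), ((n : ℝ) + 1)⁻¹ • T^[i] A₀ with hc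
  have hcK : ∀ n, c n ∈ K := by
    intro n
    refine hconv.sum_mem (fun _ _ => by positivity) ?_ fun i _ => hiter i
    simp only [Finset.sum_const, Finset.card_range, nsmul_eq_mul]
    push_cast
    exact mul_inv_cancel₀ (by positivity)
  have hcompact : IsCompact K :=
    (isCompact_univ_pi fun j => isCompact_Icc (a := -C j) (b := C j)).of_isClosed_subset hclosed
      fun A hA j _ => abs_le.1 (hbdd A hA j)
  let U : Ultrafilter ℕ := hyperfilter ℕ
  obtain ⟨B, hBK, hB⟩ := hcompact.ultrafilter_le_nhds (U.map c)
    (by rw [Ultrafilter.coe_map, le_principal_iff, mem_map]; exact univ_mem' hcK)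
  have hlim : ∀ j, Tendsto (fun n => c n j) U (𝓝 (B j)) := fun j =>
    (tendsto_pi_nhds.1 (show Tendsto c U (𝓝 B) from hB)) j
  refine ⟨B, hBK, fun j => ?_⟩
  have hTlim : Tendsto (fun n => ∑' h, μ.w h * c n (σ h j)) U (𝓝 (∑' h, μ.w h * B (σ h j))) := by
    refine tendsto_tsum_of_dominated_convergence (bound := fun h => μ.w h * C j)
      (μ.hasSum.summable.mul_right _) (fun h => (hlim (σ h j)).const_mul _)
      (Eventually.of_forall fun n h => ?_)
    rw [Real.norm_eq_abs, abs_mul, abs_of_nonneg (μ.nonneg h)]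
    exact mul_le_mul_of_nonneg_left (hbdd' _ (hcK n) h j) (μ.nonneg h)
  have hTc : ∀ n, ∑' h, μ.w h * c n (σ h j)
      = c n j + ((n : ℝ) + 1)⁻¹ * (T^[n + 1] A₀ j - A₀ j) := by
    intro n
    have hsum : ∑' h, μ.w h * c n (σ h j)
        = ∑ i ∈ Finset.range (n + 1), ((n : ℝ) + 1)⁻¹ * T^[i + 1] A₀ j := by
      have : ∀ i, T^[i + 1] A₀ j = ∑' h, μ.w h * T^[i] A₀ (σ h j) := fun i => by
        rw [Function.iterate_succ_apply']
      simp only [this, ← tsum_mul_left]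
      rw [← Summable.tsum_finsetSum fun i _ =>
        (μ.summable_mul fun h => hbdd' _ (hiter i) h j).mul_left _]
      refine tsum_congr fun h => ?_
      simp only [hc, Finset.sum_apply, Pi.smul_apply, smul_eq_mul, Finset.mul_sum]
      exact Finset.sum_congr rfl fun i _ => by ring
    rw [hsum]
    simp only [hc, Finset.sum_apply, Pi.smul_apply, smul_eq_mul, ← Finset.mul_sum]
    rw [← mul_add]
    congr 1
    have h := Finset.sum_range_sub (fun i => T^[i] A₀ j) (n + 1)
    rw [Finset.sum_sub_distrib] at h
    simp only [Function.iterate_zero, id] at h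
    linarith
  have hzero : Tendsto (fun n : ℕ => ((n : ℝ) + 1)⁻¹ * (T^[n + 1] A₀ j - A₀ j)) atTop (𝓝 0) := by
    have h1 : Tendsto (fun n : ℕ => ((n : ℝ) + 1)⁻¹) atTop (𝓝 0) := by
      simpa using tendsto_one_div_add_atTop_nhds_zero_nat (𝕜 := ℝ)
    refine h1.zero_mul_isBoundedUnder_le ?_
    refine isBoundedUnder_of ⟨C j + C j, fun n => ?_⟩
    simp only [Function.comp_apply, Real.norm_eq_abs]
    exact (abs_sub _ _).trans (add_le_add (hbdd _ (hiter _) j) (hbdd _ hA₀ j))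
  have hlim2 := (hlim j).add (hzero.mono_left (Nat.hyperfilter_le_atTop))
  simp only [← hTc, add_zero] at hlim2
  exact tendsto_nhds_unique hlim2 hTlim

end FixedPoint

end RW
namespace RW

section FixedFamily

variable {Γ : Type*} [Group Γ] {Y : Type*} [TopologicalSpace Y] [MulAction Γ Y]
  [ContinuousConstSMul Γ Y]

/-- Precomposition of a continuous function with the action of `g`. -/
def translate (g : Γ) (f : C(Y, ℝ)) : C(Y, ℝ) :=
  f.comp ⟨fun y => g • y, continuous_const_smul g⟩

@[simp] lemma translate_apply (g : Γ) (f : C(Y, ℝ)) (y : Y) : translate g f y = f (g • y) := rfl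

lemma translate_translate (h g : Γ) (f : C(Y, ℝ)) :
    translate h (translate g f) = translate (g * h) f := by
  ext y; simp [mul_smul]

@[simp] lemma translate_one (g : Γ) : translate g (1 : C(Y, ℝ)) = 1 := rfl

lemma translate_add (g : Γ) (f f' : C(Y, ℝ)) :
    translate g (f + f') = translate g f + translate g f' := rfl

lemma translate_smul (g : Γ) (r : ℝ) (f : C(Y, ℝ)) :
    translate g (r • f) = r • translate g f := rfl

lemma translate_nonneg (g : Γ) {f : C(Y, ℝ)} (hf : 0 ≤ f) : 0 ≤ translate g f :=
  fun y => hf (g • y)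

/-- A family of positive functionals `A (g, ·)` on `C(Y)`, indexed by `g : Γ`, such that
`A (g, ·)` is `g`-invariant, is dominated by `A (1, ·)`, and has total mass `c g`. Such a family
describes a positive functional on the crossed product of `C(Y)` by `Γ`. -/
structure IsFixedFamily (c : Γ → ℝ) (A : Γ × C(Y, ℝ) → ℝ) : Prop where
  add : ∀ g f f', A (g, f + f') = A (g, f) + A (g, f')
  smul : ∀ g (r : ℝ) f, A (g, r • f) = r * A (g, f)
  nonneg : ∀ g f, 0 ≤ f → 0 ≤ A (g, f)
  le_one : ∀ g f, 0 ≤ f → A (g, f) ≤ A (1, f)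
  mass : ∀ g, A (g, 1) = c g
  inv : ∀ g f, A (g, translate g f) = A (g, f)

/-- The action of `Γ` on the index set of a fixed family. -/
def conjIndex (h : Γ) (j : Γ × C(Y, ℝ)) : Γ × C(Y, ℝ) := (h⁻¹ * j.1 * h, translate h j.2)

namespace IsFixedFamily

variable {c : Γ → ℝ} {A : Γ × C(Y, ℝ) → ℝ}

lemma mono (hA : IsFixedFamily c A) (g : Γ) {f f' : C(Y, ℝ)} (h : f ≤ f') :
    A (g, f) ≤ A (g, f') := by
  have h1 := hA.add g f (f' - f)
  have h2 := hA.nonneg g (f' - f) (sub_nonneg.2 h)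
  rw [add_sub_cancel] at h1
  linarith

lemma mass_nonneg (hA : IsFixedFamily c A) (g : Γ) : 0 ≤ c g := by
  rw [← hA.mass]
  exact hA.nonneg g 1 zero_le_one

lemma mass_le_one (hA : IsFixedFamily c A) (hc : c 1 = 1) (g : Γ) : c g ≤ 1 := by
  rw [← hc, ← hA.mass, ← hA.mass]
  exact hA.le_one g 1 zero_le_one

lemma abs_le_norm [CompactSpace Y] (hA : IsFixedFamily c A) (hc : c 1 = 1)
    (j : Γ × C(Y, ℝ)) : |A j| ≤ ‖j.2‖ := by
  obtain ⟨g, f⟩ := j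
  have hcst : ∀ r : ℝ, A (g, r • 1) = r * c g := fun r => by rw [hA.smul, hA.mass]
  have h1 : A (g, f) ≤ A (g, ‖f‖ • 1) := hA.mono g fun y => by
    simpa using (le_abs_self _).trans (f.norm_coe_le_norm y)
  have h2 : A (g, (-‖f‖) • 1) ≤ A (g, f) := hA.mono g fun y => by
    simpa using neg_le_of_abs_le (f.norm_coe_le_norm y)
  rw [hcst] at h1 h2
  have h3 := mul_le_mul_of_nonneg_left (hA.mass_le_one hc g) (norm_nonneg f)
  exact abs_le.2 ⟨by simp only; linarith, by simp only; linarith⟩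

end IsFixedFamily

lemma norm_translate_le [CompactSpace Y] (g : Γ) (f : C(Y, ℝ)) : ‖translate g f‖ ≤ ‖f‖ :=
  (ContinuousMap.norm_le _ (norm_nonneg f)).2 fun y => f.norm_coe_le_norm (g • y)

lemma isClosed_isFixedFamily (c : Γ → ℝ) :
    IsClosed {A : Γ × C(Y, ℝ) → ℝ | IsFixedFamily c A} := by
  have h : {A : Γ × C(Y, ℝ) → ℝ | IsFixedFamily c A} =
      (⋂ (g) (f) (f'), {A | A (g, f + f') = A (g, f) + A (g, f')}) ∩
      (⋂ (g) (r : ℝ) (f), {A | A (g, r • f) = r * A (g, f)}) ∩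
      (⋂ (g) (f) (_ : 0 ≤ f), {A | 0 ≤ A (g, f)}) ∩
      (⋂ (g) (f) (_ : 0 ≤ f), {A | A (g, f) ≤ A (1, f)}) ∩
      (⋂ g, {A | A (g, 1) = c g}) ∩
      (⋂ (g) (f), {A | A (g, translate g f) = A (g, f)}) := by
    ext A
    simp only [Set.mem_inter_iff, Set.mem_iInter, Set.mem_ofPred_eq]
    exact ⟨fun ⟨h1, h2, h3, h4, h5, h6⟩ => ⟨⟨⟨⟨⟨h1, h2⟩, h3⟩, h4⟩, h5⟩, h6⟩,
      fun ⟨⟨⟨⟨⟨h1, h2⟩, h3⟩, h4⟩, h5⟩, h6⟩ => ⟨h1, h2, h3, h4, h5, h6⟩⟩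
  rw [h]
  refine IsClosed.inter (IsClosed.inter (IsClosed.inter (IsClosed.inter (IsClosed.inter
    ?_ ?_) ?_) ?_) ?_) ?_ <;> refine isClosed_iInter fun g => ?_
  · exact isClosed_iInter fun f => isClosed_iInter fun f' =>
      isClosed_eq (by fun_prop) (by fun_prop)
  · exact isClosed_iInter fun f => isClosed_iInter fun f' =>
      isClosed_eq (by fun_prop) (by fun_prop)
  · exact isClosed_iInter fun f => isClosed_iInter fun _ =>
      isClosed_le (by fun_prop) (by fun_prop)
  · exact isClosed_iInter fun f => isClosed_iInter fun _ =>
      isClosed_le (by fun_prop) (by fun_prop)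
  · exact isClosed_eq (by fun_prop) (by fun_prop)
  · exact isClosed_iInter fun f => isClosed_eq (by fun_prop) (by fun_prop)

lemma convex_isFixedFamily (c : Γ → ℝ) :
    Convex ℝ {A : Γ × C(Y, ℝ) → ℝ | IsFixedFamily c A} := by
  rintro A (hA : IsFixedFamily c A) B (hB : IsFixedFamily c B) a b ha hb hab
  refine ⟨fun g f f' => ?_, fun g r f => ?_, fun g f hf => ?_, fun g f hf => ?_, fun g => ?_,
    fun g f => ?_⟩ <;> simp only [Pi.add_apply, Pi.smul_apply, smul_eq_mul]
  · rw [hA.add, hB.add]; ring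
  · rw [hA.smul, hB.smul]; ring
  · exact add_nonneg (mul_nonneg ha (hA.nonneg g f hf)) (mul_nonneg hb (hB.nonneg g f hf))
  · exact add_le_add (mul_le_mul_of_nonneg_left (hA.le_one g f hf) ha)
      (mul_le_mul_of_nonneg_left (hB.le_one g f hf) hb)
  · rw [hA.mass, hB.mass, ← add_mul, hab, one_mul]
  · rw [hA.inv, hB.inv]

lemma IsFixedFamily.average [CompactSpace Y] {c : Γ → ℝ} {A : Γ × C(Y, ℝ) → ℝ} (μ : ProbOn Γ)
    (hA : IsFixedFamily c A) (hc : c 1 = 1)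
    (hcμ : ∀ g, c g = ∑' h, μ.w h * c (h⁻¹ * g * h)) :
    IsFixedFamily c fun j => ∑' h, μ.w h * A (conjIndex h j) := by
  have hs : ∀ j, Summable fun h => μ.w h * A (conjIndex h j) := fun j =>
    μ.summable_mul fun h => (hA.abs_le_norm hc _).trans (norm_translate_le h j.2)
  refine ⟨fun g f f' => ?_, fun g r f => ?_, fun g f hf => ?_, fun g f hf => ?_, fun g => ?_,
    fun g f => ?_⟩
  · rw [← (hs _).tsum_add (hs _)]
    refine tsum_congr fun h => ?_
    simp only [conjIndex, translate_add, hA.add, mul_add]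
  · rw [← tsum_mul_left]
    refine tsum_congr fun h => ?_
    simp only [conjIndex, translate_smul, hA.smul]
    ring
  · exact tsum_nonneg fun h =>
      mul_nonneg (μ.nonneg h) (hA.nonneg _ _ (translate_nonneg h hf))
  · refine (hs _).tsum_le_tsum (fun h => mul_le_mul_of_nonneg_left ?_ (μ.nonneg h)) (hs _)
    simpa [conjIndex] using hA.le_one (h⁻¹ * g * h) _ (translate_nonneg h hf)
  · rw [hcμ g]
    refine tsum_congr fun h => ?_
    simp only [conjIndex, translate_one, hA.mass]
  · refine tsum_congr fun h => ?_
    have h1 : translate h (translate g f) = translate (h⁻¹ * g * h) (translate h f) := by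
      rw [translate_translate, translate_translate]
      congr 1
      group
    simp only [conjIndex, h1, hA.inv]

end FixedFamily

section Boundary

variable {Γ : Type*} [Group Γ] {Y : Type*} [TopologicalSpace Y] [CompactSpace Y]
  [TopologicalSpace.MetrizableSpace Y] [MeasurableSpace Y] [BorelSpace Y] [MulAction Γ Y]
  [ContinuousConstSMul Γ Y] {c : Γ → ℝ} {A : Γ × C(Y, ℝ) → ℝ}

lemma IsFixedFamily.exists_measure (hA : IsFixedFamily c A) (hc : c 1 = 1) :
    ∃ ρ : Measure Y, IsProbabilityMeasure ρ ∧ ∀ f : C(Y, ℝ), ∫ y, f y ∂ρ = A (1, f) := by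
  let Φ : CompactlySupportedContinuousMap Y ℝ →ₚ[ℝ] ℝ :=
    PositiveLinearMap.mk₀
      { toFun := fun f => A (1, f.toContinuousMap)
        map_add' := fun f f' => hA.add 1 _ _
        map_smul' := fun r f => hA.smul 1 r _ }
      fun f hf => hA.nonneg 1 _ hf
  have hint : ∀ f : C(Y, ℝ), ∫ y, f y ∂(RealRMK.rieszMeasure Φ) = A (1, f) := fun f =>
    RealRMK.integral_rieszMeasure Φ (CompactlySupportedContinuousMap.continuousMapEquiv f)
  refine ⟨RealRMK.rieszMeasure Φ, ⟨?_⟩, hint⟩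
  have h1 := hint 1
  rw [hA.mass, hc] at h1
  simp only [ContinuousMap.one_apply, integral_const, smul_eq_mul, mul_one] at h1
  rwa [Measure.real, ENNReal.toReal_eq_one_iff] at h1

lemma integrable_continuousMap (ρ : Measure Y) [IsFiniteMeasure ρ] (f : C(Y, ℝ)) :
    Integrable f ρ :=
  Integrable.of_bound f.continuous.measurable.aestronglyMeasurable ‖f‖
    (Eventually.of_forall f.norm_coe_le_norm)

/-- On a uniquely stationary space, the functional at the identity of a stationary fixed family
is integration against the stationary measure. -/
lemma IsFixedFamily.eq_integral {μ : ProbOn Γ} {νY : Measure Y} (hA : IsFixedFamily c A)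
    (hc : c 1 = 1) (hfix : ∀ j, A j = ∑' h, μ.w h * A (conjIndex h j))
    (huniq : ∀ ν' : Measure Y, IsProbabilityMeasure ν' → IsStatMeasure μ ν' → ν' = νY)
    (f : C(Y, ℝ)) : A (1, f) = ∫ y, f y ∂νY := by
  obtain ⟨ρ, hρ, hint⟩ := hA.exists_measure hc
  have hmeas : ∀ h : Γ, Measurable fun y : Y => h • y := fun h =>
    (continuous_const_smul h).measurable
  suffices hst : IsStatMeasure μ ρ by rw [← hint, huniq ρ hρ hst]
  have hprob : IsProbabilityMeasure (Measure.sum fun g : Γ =>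
      ENNReal.ofReal (μ.w g) • Measure.map (fun y : Y => g • y) ρ) := by
    refine ⟨?_⟩
    rw [Measure.sum_apply _ MeasurableSet.univ]
    simpa [Measure.map_apply (hmeas _) MeasurableSet.univ] using μ.tsum_ofReal
  refine ext_of_forall_integral_eq_of_IsFiniteMeasure fun f => ?_
  have h1 := hint f.toContinuousMap
  have h2 := integrable_continuousMap (Measure.sum fun g : Γ =>
      ENNReal.ofReal (μ.w g) • Measure.map (fun y : Y => g • y) ρ) f.toContinuousMap
  simp only [BoundedContinuousFunction.coe_toContinuousMap] at h1 h2
  rw [h1, integral_sum_measure h2, hfix]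
  refine tsum_congr fun h => ?_
  have h3 := hint (translate h f.toContinuousMap)
  rw [integral_smul_measure, integral_map (hmeas h).aemeasurable
    f.continuous.measurable.aestronglyMeasurable, ENNReal.toReal_ofReal (μ.nonneg h), smul_eq_mul]
  simp only [translate_apply, BoundedContinuousFunction.coe_toContinuousMap] at h3
  rw [h3]
  simp [conjIndex]

/-- If `ws n • νY` converges to a Dirac measure at a point that is not fixed by `g`, then the
masses of a fixed family along the conjugates of `g` tend to zero. -/
lemma IsFixedFamily.tendsto_mass {νY : Measure Y} [IsProbabilityMeasure νY]
    (hA : IsFixedFamily c A) (hint : ∀ f : C(Y, ℝ), A (1, f) = ∫ y, f y ∂νY) {ws : ℕ → Γ} {z : Y}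
    (hz : TendstoDirac νY ws z) {g : Γ} (hgz : g • z ≠ z) :
    Tendsto (fun n => c ((ws n)⁻¹ * g * ws n)) atTop (𝓝 0) := by
  obtain ⟨f, hf0, hf1, hf⟩ := exists_continuous_zero_one_of_isClosed
    (isClosed_singleton (x := z)) (isClosed_singleton (x := g • z))
    (Set.disjoint_singleton.2 hgz.symm)
  have hlim : ∀ φ : C(Y, ℝ), Tendsto (fun n => A (1, translate (ws n) φ)) atTop (𝓝 (φ z)) := by
    intro φ
    refine (hz φ).congr fun n => ?_
    rw [hint, integral_map (continuous_const_smul (ws n)).measurable.aemeasurable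
      φ.continuous.measurable.aestronglyMeasurable]
    rfl
  have hz0 : f z = 0 := hf0 rfl
  have hz1 : f (g • z) = 1 := hf1 rfl
  have h := (hlim (1 - translate g f)).add (hlim f)
  simp only [ContinuousMap.sub_apply, ContinuousMap.one_apply, translate_apply, hz0, hz1, sub_self,
    add_zero] at h
  refine squeeze_zero (fun n => hA.mass_nonneg _) (fun n => ?_) h
  set k := (ws n)⁻¹ * g * ws n with hk
  have hdec : (1 : C(Y, ℝ)) =
      translate (ws n) (1 - translate g f) + translate k (translate (ws n) f) := by
    ext y
    simp [hk, mul_smul]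
  calc c k = A (k, translate (ws n) (1 - translate g f)) + A (k, translate (ws n) f) := by
        rw [← hA.mass k, ← hA.inv k (translate (ws n) f), ← hA.add, ← hdec]
    _ ≤ _ := add_le_add
        (hA.le_one _ _ (translate_nonneg _ fun y => sub_nonneg.2 (hf _).2))
        (hA.le_one _ _ (translate_nonneg _ fun y => (hf y).1))

lemma exists_continuousMap_integral_le (νY : Measure Y) [IsProbabilityMeasure νY] {F : Set Y}
    (hF : IsClosed F) (hF0 : νY F = 0) {ε : ℝ} (hε : 0 < ε) :
    ∃ f : C(Y, ℝ), (∀ y ∈ F, f y = 1) ∧ 0 ≤ f ∧ ∫ y, f y ∂νY ≤ ε := by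
  obtain ⟨U, hFU, hU, hUε⟩ := F.exists_isOpen_lt_of_lt (μ := νY) (ENNReal.ofReal ε)
    (by rw [hF0]; exact ENNReal.ofReal_pos.2 hε)
  obtain ⟨f, hf0, hf1, hf⟩ := exists_continuous_zero_one_of_isClosed hU.isClosed_compl hF
    (Set.disjoint_left.2 fun y hy hyF => hy (hFU hyF))
  refine ⟨f, hf1, fun y => (hf y).1, ?_⟩
  calc ∫ y, f y ∂νY ≤ ∫ y, U.indicator 1 y ∂νY := by
        refine integral_mono (integrable_continuousMap νY f)
          ((integrable_const (1 : ℝ)).indicator hU.measurableSet) fun y => ?_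
        by_cases hy : y ∈ U
        · simpa [hy] using (hf y).2
        · simpa [hy] using (hf0 hy).le
    _ = νY.real U := integral_indicator_one hU.measurableSet
    _ ≤ ε := ENNReal.toReal_le_of_le_ofReal hε.le hUε.le

/-- A stationary fixed family over an essentially free `μ`-USB has no mass off the identity. -/
theorem IsFixedFamily.mass_eq_zero [Countable Γ] [MeasurableSpace Γ] [DiscreteMeasurableSpace Γ]
    {μ : ProbOn Γ} {νY : Measure Y} (hUSB : IsUSB μ νY) (hfree : IsEssFree Γ νY)
    (hA : IsFixedFamily c A) (hc : c 1 = 1) (hfix : ∀ j, A j = ∑' h, μ.w h * A (conjIndex h j))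
    {g : Γ} (hg : g ≠ 1) : c g = 0 := by
  have hprob : IsProbabilityMeasure νY := hUSB.1.1
  have hint := hA.eq_integral hc hfix hUSB.2
  refine le_antisymm (le_of_forall_pos_le_add fun ε hε => ?_) (hA.mass_nonneg g)
  rw [zero_add]
  obtain ⟨f, hf1, hf0, hfε⟩ := exists_continuousMap_integral_le νY
    (isClosed_eq (continuous_const_smul g) continuous_id) (hfree g hg) hε
  let φ : Γ → ℝ := fun γ => c (γ⁻¹ * g * γ)
  let ψ : Γ → ℝ := fun γ => A (1, translate γ f)
  have hφ0 : ∀ γ, 0 ≤ φ γ := fun γ => hA.mass_nonneg _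
  have hφ1 : ∀ γ, φ γ ≤ 1 := fun γ => hA.mass_le_one hc _
  have hψ0 : ∀ γ, 0 ≤ ψ γ := fun γ => hA.nonneg _ _ (translate_nonneg γ hf0)
  have hφb : ∀ γ, |φ γ| ≤ 1 := fun γ => abs_le.2 ⟨by linarith [hφ0 γ], hφ1 γ⟩
  have hψb : ∀ γ, |ψ γ| ≤ ‖f‖ := fun γ =>
    (hA.abs_le_norm hc _).trans (norm_translate_le γ f)
  have hφh : ∀ γ, φ γ = ∑' h, μ.w h * φ (γ * h) := fun γ => by
    have h := hfix (γ⁻¹ * g * γ, 1)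
    simp only [conjIndex, translate_one, hA.mass] at h
    simp only [φ, h]
    refine tsum_congr fun h => ?_
    congr 2
    group
  have hψh : ∀ γ, ψ γ = ∑' h, μ.w h * ψ (γ * h) := fun γ => by
    have h := hfix (1, translate γ f)
    simpa [conjIndex, translate_translate] using h
  have hmeas : ∀ (χ : Γ → ℝ) (n : ℕ),
      AEStronglyMeasurable (fun x : ℕ → Γ => χ (walk x n)) μ.bernoulli := fun χ n =>
    ((Measurable.of_discrete (f := χ)).comp (measurable_walk n)).aestronglyMeasurable
  have hD : Tendsto (fun n => ∫ x, max 0 (φ (walk x n) - ψ (walk x n)) ∂μ.bernoulli) atTop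
      (𝓝 (∫ _, (0 : ℝ) ∂μ.bernoulli)) := by
    refine tendsto_integral_of_dominated_convergence (fun _ => 1)
      (fun n => hmeas (fun γ => max 0 (φ γ - ψ γ)) n) (integrable_const _)
      (fun n => Eventually.of_forall fun x => ?_) ?_
    · rw [Real.norm_eq_abs, abs_of_nonneg (le_max_left _ _)]
      exact max_le zero_le_one (by linarith [hφ1 (walk x n), hψ0 (walk x n)])
    · filter_upwards [hUSB.1.2.2 _ μ.isBernoulli_bernoulli] with x hx
      obtain ⟨z, hz⟩ := hx
      by_cases hgz : g • z = z
      · have hψz : Tendsto (fun n => ψ (walk x n)) atTop (𝓝 1) := by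
          rw [← hf1 z hgz]
          refine (hz f).congr fun n => ?_
          rw [integral_map (continuous_const_smul _).measurable.aemeasurable
            f.continuous.measurable.aestronglyMeasurable]
          exact (hint (translate (walk x n) f)).symm
        have h0 := (tendsto_const_nhds (x := (0 : ℝ))).max
          ((tendsto_const_nhds (x := (1 : ℝ))).sub hψz)
        simp only [sub_self, max_self] at h0
        exact squeeze_zero (fun n => le_max_left _ _)
          (fun n => max_le_max_left _ (sub_le_sub_right (hφ1 _) _)) h0
      · exact squeeze_zero (fun n => le_max_left _ _)
          (fun n => max_le (hφ0 _) (sub_le_self _ (hψ0 _))) (hA.tendsto_mass hint hz hgz)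
  rw [integral_zero] at hD
  have hle : ∀ n, c g ≤ ∫ x, max 0 (φ (walk x n) - ψ (walk x n)) ∂μ.bernoulli + ε := by
    intro n
    have h1 := μ.integral_walk_of_harmonic hφb hφh n
    have h2 := μ.integral_walk_of_harmonic hψb hψh n
    have hiφ : Integrable (fun x => φ (walk x n)) μ.bernoulli :=
      Integrable.of_bound (hmeas φ n) 1 (Eventually.of_forall fun x => hφb _)
    have hiψ : Integrable (fun x => ψ (walk x n)) μ.bernoulli :=
      Integrable.of_bound (hmeas ψ n) ‖f‖ (Eventually.of_forall fun x => hψb _)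
    have h3 : ∫ x, (φ (walk x n) - ψ (walk x n)) ∂μ.bernoulli
        ≤ ∫ x, max 0 (φ (walk x n) - ψ (walk x n)) ∂μ.bernoulli :=
      integral_mono (hiφ.sub hiψ) ((integrable_zero _ _ _).sup (hiφ.sub hiψ))
        fun x => le_max_right _ _
    rw [integral_sub hiφ hiψ, h1, h2] at h3
    have h4 : φ 1 = c g := by simp [φ]
    have h5 : ψ 1 ≤ ε := by
      simp only [ψ, hint, translate_apply, one_smul]
      exact hfε
    linarith
  have hlim := hD.add_const ε
  rw [zero_add] at hlim
  exact ge_of_tendsto' hlim hle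

end Boundary

end RW
namespace RW

section Section

variable {Γ : Type*} [Group Γ] {X S : Type*} [MulAction Γ X] [MulAction Γ S]

/-- `k` moves the element of smallest index in the orbit of `s` under the stabilizer of `x`
to `s`. -/
def IsOrbitShift (e : S → ℕ) (x : X) (s : S) (k : Γ) : Prop :=
  k • x = x ∧ ∀ k' : Γ, k' • x = x → e (k⁻¹ • s) ≤ e (k'⁻¹ • s)

/-- The points whose stabilizer acts freely on `S`. -/
def freeLocus (Γ X S : Type*) [Group Γ] [MulAction Γ X] [MulAction Γ S] : Set X :=
  {x | ∀ (s : S) (k : Γ), k • x = x → k • s = s → k = 1}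

lemma exists_isOrbitShift (e : S → ℕ) (x : X) (s : S) : ∃ k : Γ, IsOrbitShift e x s k := by
  obtain ⟨k, hk, hmin⟩ := WellFounded.has_min
    (InvImage.wf (fun k : Γ => e (k⁻¹ • s)) Nat.lt_wfRel.wf) {k : Γ | k • x = x} ⟨1, one_smul Γ x⟩
  exact ⟨k, hk, fun k' hk' => not_lt.1 (hmin k' hk')⟩

lemma IsOrbitShift.smul {e : S → ℕ} {x : X} {s : S} {k g : Γ} (h : IsOrbitShift e x s k)
    (hg : g • x = x) : IsOrbitShift e x (g • s) (g * k) := by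
  refine ⟨by rw [mul_smul, h.1, hg], fun k' hk' => ?_⟩
  have h1 := h.2 (g⁻¹ * k') (by rw [mul_smul, hk', inv_smul_eq_iff, hg])
  simpa [mul_smul] using h1

lemma IsOrbitShift.unique {e : S → ℕ} (he : Function.Injective e) {x : X} {s : S} {k k' : Γ}
    (hx : x ∈ freeLocus Γ X S) (h : IsOrbitShift e x s k) (h' : IsOrbitShift e x s k') :
    k = k' := by
  have heq : k⁻¹ • s = k'⁻¹ • s := he (le_antisymm (h.2 k' h'.1) (h'.2 k h.1))
  have h1 : k * k'⁻¹ = 1 := by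
    refine hx s _ ?_ ?_
    · rw [mul_smul, inv_smul_eq_iff.2 h'.1.symm, h.1]
    · rw [mul_smul, ← heq, smul_inv_smul]
  exact mul_inv_eq_one.1 h1

open Classical in
/-- For each `x` in the free locus, an equivariant map from `S` to the stabilizer of `x`. -/
def orbitShift (e : S → ℕ) (x : X) (s : S) : Γ :=
  if x ∈ freeLocus Γ X S then (exists_isOrbitShift (Γ := Γ) e x s).choose else 1

lemma isOrbitShift_orbitShift (e : S → ℕ) {x : X} (hx : x ∈ freeLocus Γ X S) (s : S) :
    IsOrbitShift e x s (orbitShift e x s : Γ) := by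
  rw [orbitShift, if_pos hx]
  exact (exists_isOrbitShift (Γ := Γ) e x s).choose_spec

lemma orbitShift_smul {e : S → ℕ} (he : Function.Injective e) {x : X}
    (hx : x ∈ freeLocus Γ X S) (s : S) {g : Γ} (hg : g • x = x) :
    (orbitShift e x (g • s) : Γ) = g * orbitShift e x s :=
  (isOrbitShift_orbitShift e hx _).unique he hx ((isOrbitShift_orbitShift e hx s).smul hg)

variable [MeasurableSpace X] [Countable Γ]

lemma measurableSet_freeLocus [Countable S]
    (hfix : ∀ g : Γ, MeasurableSet (MulAction.fixedBy X g)) :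
    MeasurableSet (freeLocus Γ X S) := by
  have h : freeLocus Γ X S =
      ⋂ (s : S) (k : Γ) (_ : k • s = s) (_ : k ≠ 1), (MulAction.fixedBy X k)ᶜ := by
    ext x
    simp only [freeLocus, Set.mem_ofPred_eq, Set.mem_iInter, Set.mem_compl_iff,
      MulAction.mem_fixedBy]
    exact ⟨fun h s k hs hk hx => hk (h s k hx hs), fun h s k hx hs => by
      by_contra hk; exact h s k hs hk hx⟩
  rw [h]
  exact .iInter fun s => .iInter fun k => .iInter fun _ => .iInter fun _ => (hfix k).compl

lemma measurable_orbitShift [Countable S] [MeasurableSpace Γ] [DiscreteMeasurableSpace Γ]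
    {e : S → ℕ} (he : Function.Injective e)
    (hfix : ∀ g : Γ, MeasurableSet (MulAction.fixedBy X g)) (s : S) :
    Measurable fun x : X => (orbitShift e x s : Γ) := by
  have hshift : ∀ k : Γ, MeasurableSet {x : X | IsOrbitShift e x s k} := by
    intro k
    have h : {x : X | IsOrbitShift e x s k} = MulAction.fixedBy X k ∩
        ⋂ (k' : Γ) (_ : ¬ e (k⁻¹ • s) ≤ e (k'⁻¹ • s)), (MulAction.fixedBy X k')ᶜ := by
      ext x
      simp only [IsOrbitShift, Set.mem_ofPred_eq, Set.mem_inter_iff, Set.mem_iInter,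
        Set.mem_compl_iff, MulAction.mem_fixedBy]
      exact and_congr_right fun _ => forall_congr' fun k' => not_imp_not.symm
    rw [h]
    exact (hfix k).inter (.iInter fun k' => .iInter fun _ => (hfix k').compl)
  refine measurable_to_countable' fun k => ?_
  have h : (fun x : X => (orbitShift e x s : Γ)) ⁻¹' {k} =
      (freeLocus Γ X S ∩ {x | IsOrbitShift e x s k}) ∪
        ((freeLocus Γ X S)ᶜ ∩ {_x | (1 : Γ) = k}) := by
    ext x
    simp only [Set.mem_preimage, Set.mem_singleton_iff, Set.mem_union, Set.mem_inter_iff,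
      Set.mem_compl_iff, Set.mem_ofPred_eq]
    by_cases hx : x ∈ freeLocus Γ X S
    · simp only [hx, true_and, not_true, false_and, or_false]
      exact ⟨fun h => h ▸ isOrbitShift_orbitShift e hx s,
        fun h => (isOrbitShift_orbitShift e hx s).unique he hx h⟩
    · simp [hx, orbitShift]
  rw [h]
  have hF := measurableSet_freeLocus (S := S) hfix
  exact (hF.inter (hshift k)).union (hF.compl.inter (.const _))

end Section

section Construction

variable {Γ : Type*} [Group Γ] [Countable Γ] {X : Type*} [MeasurableSpace X] [MulAction Γ X]

lemma ae_mem_freeLocus {ν : Measure X} {Λ : Subgroup Γ}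
    (hmeas : ∀ g : Γ, Measurable fun x : X => g • x)
    (hfix : ∀ g : Γ, MeasurableSet (MulAction.fixedBy X g))
    (hns : IsNonSingular Γ ν) (hΛ : IsEssFreeOn Λ ν) :
    ∀ᵐ x ∂ν, x ∈ freeLocus Γ X (Γ ⧸ Λ) := by
  have : Countable (Γ ⧸ Λ) := Quotient.countable
  have hnull : ∀ (s : Γ ⧸ Λ) (k : Γ), k • s = s → k ≠ 1 → ν (MulAction.fixedBy X k) = 0 := by
    intro s k hs hk
    obtain ⟨γ, rfl⟩ := QuotientGroup.mk_surjective s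
    have hmem : γ⁻¹ * k * γ ∈ Λ := by
      have h := QuotientGroup.eq.1 hs.symm
      simpa [mul_assoc] using h
    refine (hns γ).2 ?_
    rw [Measure.map_apply (hmeas γ) (hfix k)]
    have hpre : (fun x : X => γ • x) ⁻¹' MulAction.fixedBy X k
        = MulAction.fixedBy X (γ⁻¹ * k * γ) := by
      ext x
      exact mem_fixedBy_conj.symm
    rw [hpre]
    refine hΛ _ hmem fun h => hk ?_
    have h' := congrArg (fun a => γ * a * γ⁻¹) h
    simpa [mul_assoc] using h'
  simp only [freeLocus, Set.mem_ofPred_eq, ae_all_iff]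
  intro s k
  by_cases hk : k = 1
  · exact Eventually.of_forall fun _ _ _ => hk
  by_cases hs : k • s = s
  · have h : ∀ᵐ x ∂ν, x ∉ MulAction.fixedBy X k :=
      measure_eq_zero_iff_ae_notMem.1 (hnull s k hs hk)
    filter_upwards [h] with x hx hkx
    exact absurd hkx hx
  · exact Eventually.of_forall fun _ _ h => absurd h hs

variable {Y : Type*} [TopologicalSpace Y] [CompactSpace Y] [MulAction Γ Y]
  [ContinuousConstSMul Γ Y] [MeasurableSpace Γ] [DiscreteMeasurableSpace Γ]

/-- A co-amenable subgroup acting essentially freely gives rise to a fixed family whose masses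
are the measures of the fixed point sets. -/
theorem exists_isFixedFamily [Nonempty Y] {ν : Measure X} [IsProbabilityMeasure ν]
    {S : Type*} [MulAction Γ S] [Countable S] (hS : HasInvariantMean Γ S)
    (hfix : ∀ g : Γ, MeasurableSet (MulAction.fixedBy X g))
    (hfree : ∀ᵐ x ∂ν, x ∈ freeLocus Γ X S) :
    ∃ A : Γ × C(Y, ℝ) → ℝ, IsFixedFamily (fun g => ν.real (MulAction.fixedBy X g)) A := by
  obtain ⟨m, hpos, hone, hinv⟩ := hS
  obtain ⟨e, he⟩ := exists_injective_nat S
  obtain ⟨y₀⟩ := ‹Nonempty Y›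
  let q : X → S → Y := fun x s => (orbitShift e x s : Γ) • y₀
  have hint : ∀ (g : Γ) (f : C(Y, ℝ)) (s : S),
      Integrable (fun x => f (q x s)) (ν.restrict (MulAction.fixedBy X g)) := fun g f s =>
    Integrable.of_bound ((Measurable.of_discrete (f := fun k : Γ => f (k • y₀))).comp
      (measurable_orbitShift he hfix s)).aestronglyMeasurable ‖f‖
      (Eventually.of_forall fun x => f.norm_coe_le_norm _)
  let I : Γ → C(Y, ℝ) → S → ℝ := fun g f s => ∫ x in MulAction.fixedBy X g, f (q x s) ∂ν
  have hI : ∀ g f, Memℓp (I g f) ∞ := fun g f => by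
    refine memℓp_infty ⟨‖f‖, ?_⟩
    rintro _ ⟨s, rfl⟩
    refine (norm_integral_le_of_norm_le_const
      (Eventually.of_forall fun x => f.norm_coe_le_norm (q x s))).trans ?_
    exact mul_le_of_le_one_right (norm_nonneg f) (by simp)
  let F : Γ → C(Y, ℝ) → lp (fun _ : S => ℝ) ∞ := fun g f => ⟨I g f, hI g f⟩
  have hF : ∀ g f s, F g f s = ∫ x in MulAction.fixedBy X g, f (q x s) ∂ν := fun _ _ _ => rfl
  refine ⟨fun j => m (F j.1 j.2), fun g f f' => ?_, fun g r f => ?_, fun g f hf => ?_,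
    fun g f hf => ?_, fun g => ?_, fun g f => ?_⟩
  · rw [← map_add]
    congr 1
    ext s
    simp only [lp.coeFn_add, Pi.add_apply, hF, ContinuousMap.add_apply]
    exact integral_add (hint g f s) (hint g f' s)
  · rw [← smul_eq_mul, ← map_smul]
    congr 1
    ext s
    simp only [lp.coeFn_smul, Pi.smul_apply, hF, ContinuousMap.smul_apply]
    exact integral_smul r _
  · exact hpos _ fun s => integral_nonneg fun x => hf _
  · rw [← sub_nonneg, ← map_sub]
    refine hpos _ fun s => ?_
    simp only [lp.coeFn_sub, Pi.sub_apply, hF, sub_nonneg]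
    have h1 : MulAction.fixedBy X (1 : Γ) = Set.univ := by ext; simp
    have h2 := hint 1 f s
    rw [h1] at h2 ⊢
    exact setIntegral_mono_set h2 (Eventually.of_forall fun x => hf _)
      (Eventually.of_forall fun x _ => trivial)
  · have h : F g 1 = ν.real (MulAction.fixedBy X g) • 1 := by
      ext s
      simp [hF, lp.infty_coeFn_one]
    simp only [h, map_smul, hone, smul_eq_mul, mul_one]
  · have h : F g (translate g f) = lpShift g⁻¹ (F g f) := by
      ext s
      change _ = F g f (g⁻¹⁻¹ • s)
      rw [hF, hF, inv_inv]
      refine setIntegral_congr_ae (hfix g) ?_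
      filter_upwards [hfree] with x hx hg
      simp only [translate_apply, q, orbitShift_smul he hx s hg, mul_smul]
    simp only [h, hinv]

end Construction

end RW
open RW in
/-- If `Γ` admits an essentially free `μ`-USB and `Λ ≤ Γ` is co-amenable, then a
non-singular `μ`-stationary action whose restriction to `Λ` is essentially free is
essentially free. -/
theorem usb_coamenable_relative_freeness
    {Γ : Type*} [Group Γ] [Countable Γ] [MeasurableSpace Γ] [DiscreteMeasurableSpace Γ]
    (μ : ProbOn Γ)
    {Y : Type*} [TopologicalSpace Y] [CompactSpace Y] [TopologicalSpace.MetrizableSpace Y]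
    [MeasurableSpace Y] [BorelSpace Y] [MulAction Γ Y]
    (hcontY : ∀ g : Γ, Continuous fun y : Y => g • y)
    (νY : Measure Y) (hUSB : IsUSB μ νY) (hfreeY : IsEssFree Γ νY)
    (Λ : Subgroup Γ) (hco : IsCoamenable Λ)
    {X : Type*} [MeasurableSpace X] [StandardBorelSpace X] [MulAction Γ X]
    (hmeas : ∀ g : Γ, Measurable fun x : X => g • x)
    (ν : Measure X) [IsProbabilityMeasure ν]
    (hns : IsNonSingular Γ ν) (hstat : IsStatMeasure μ ν)
    (hΛfree : IsEssFreeOn Λ ν) :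
    IsEssFree Γ ν := by

  have : ContinuousConstSMul Γ Y := ⟨hcontY⟩
  have : IsProbabilityMeasure νY := hUSB.1.1
  have : Nonempty Y := nonempty_of_isProbabilityMeasure νY
  have hfix : ∀ g : Γ, MeasurableSet (MulAction.fixedBy X g) := fun g =>
    measurableSet_eq_fun (hmeas g) measurable_id
  let c : Γ → ℝ := fun g => ν.real (MulAction.fixedBy X g)
  have hc : c 1 = 1 := by
    have h : MulAction.fixedBy X (1 : Γ) = Set.univ := by ext; simp
    simp [c, h]
  have hcμ : ∀ g, c g = ∑' h, μ.w h * c (h⁻¹ * g * h) := fun g => hstat.real_fixedBy hmeas hfix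
  have : Countable (Γ ⧸ Λ) := Quotient.countable
  have hne : {A : Γ × C(Y, ℝ) → ℝ | IsFixedFamily c A}.Nonempty :=
    exists_isFixedFamily hco hfix (ae_mem_freeLocus hmeas hfix hns hΛfree)
  obtain ⟨A, hA, hAfix⟩ := μ.exists_fixed_of_convex conjIndex (C := fun j => ‖j.2‖)
    (fun h j => norm_translate_le h j.2) (isClosed_isFixedFamily c) (convex_isFixedFamily c) hne
    (fun A hA => IsFixedFamily.abs_le_norm hA hc)
    (fun A hA => IsFixedFamily.average μ hA hc hcμ)
  intro g hg
  exact (measureReal_eq_zero_iff).1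
    (IsFixedFamily.mass_eq_zero hUSB hfreeY hA hc hAfix hg : c g = 0)
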